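/- arXiv:1110.0691 — 3 statements merged into one kernel-verified Lean document; each statement's English description precedes it below -/
import Mathlib

section
/- (Composition formula.) Let F : ℂ^n × ℝ^a → ℝ and G : ℂ^n × ℝ^b → ℝ be C¹ functions, and define F♯G : ℂ^n × (ℂ^n × ℂ^n × ℝ^a × ℝ^b) → ℝ by (F♯G)(u; v, w, μ, η) = F(u+w; μ) + G(v+w; η) + 2⟨u−v, i·w⟩, where the base variable is u and the fiber variables are (v,w,μ,η). Then L(F♯G) equals the relational composition of L(F) and L(G): L(F♯G) = {(z, Z) ∈ ℂ^n × ℂ^n : ∃ Y ∈ ℂ^n, (z, Y) ∈ L(F) and (Y, Z) ∈ L(G)}. In particular, if F is a generating function for Φ and G is a generating function for Ψ, then F♯G is a generating function for Ψ∘Φ. -/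
open scoped RealInnerProductSpace

noncomputable section

abbrev Cn (n : ℕ) := EuclideanSpace ℂ (Fin n)

variable {n : ℕ}

/-- The subset `L(F)` of `ℂⁿ × ℂⁿ` associated to a function `F : ℂⁿ × V → ℝ` (base `ℂⁿ`, fiber
`V`): pairs `(z, Z)` such that for some fiber point `μ`, the derivative of `F` at
`((z+Z)/2, μ)` vanishes in all fiber directions and the gradient of `F(·, μ)` at `(z+Z)/2`
(for the real inner product) is `i(z-Z)`. -/
def GenSet {V : Type*} [NormedAddCommGroup V] [NormedSpace ℝ V]
    (F : Cn n × V → ℝ) : Set (Cn n × Cn n) :=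
  {p | ∃ μ : V,
    (∀ η : V, fderiv ℝ F ((2 : ℝ)⁻¹ • (p.1 + p.2), μ) (0, η) = 0) ∧
    (∀ u : Cn n, fderiv ℝ F ((2 : ℝ)⁻¹ • (p.1 + p.2), μ) (u, 0)
      = ⟪Complex.I • (p.1 - p.2), u⟫)}

/-- `F` is a generating function for the map `Φ : ℂⁿ → ℂⁿ` if `L(F)` is the graph of `Φ`. -/
def IsGenFun {V : Type*} [NormedAddCommGroup V] [NormedSpace ℝ V]
    (F : Cn n × V → ℝ) (Φ : Cn n → Cn n) : Prop :=
  GenSet F = {p : Cn n × Cn n | p.2 = Φ p.1}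

/-- The composition `F♯G` of two generating functions:
`(F♯G)(u; v, w, μ, η) = F(u+w; μ) + G(v+w; η) + 2⟨u−v, i·w⟩`, with base variable `u` and fiber
variables `(v, w, μ, η)`. -/
def sharp {a b : ℕ} (F : Cn n × EuclideanSpace ℝ (Fin a) → ℝ)
    (G : Cn n × EuclideanSpace ℝ (Fin b) → ℝ) :
    Cn n × (Cn n × Cn n × EuclideanSpace ℝ (Fin a) × EuclideanSpace ℝ (Fin b)) → ℝ :=
  fun p =>
    F (p.1 + p.2.2.1, p.2.2.2.1) + G (p.2.1 + p.2.2.1, p.2.2.2.2) +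
      2 * ⟪p.1 - p.2.1, Complex.I • p.2.2.1⟫

end

theorem innerI {n : ℕ} (x y : Cn n) : ⟪Complex.I • x, y⟫ = -⟪x, Complex.I • y⟫ := by
  simp only [PiLp.inner_apply, ← Finset.sum_neg_distrib]
  refine Finset.sum_congr rfl fun i _ => ?_
  simp [Complex.inner]
  ring

theorem fderiv_sharp {n a b : ℕ}
    (F : Cn n × EuclideanSpace ℝ (Fin a) → ℝ) (G : Cn n × EuclideanSpace ℝ (Fin b) → ℝ)
    (hF : ContDiff ℝ 1 F) (hG : ContDiff ℝ 1 G) (u v w : Cn n) (μ : EuclideanSpace ℝ (Fin a))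
    (η : EuclideanSpace ℝ (Fin b)) (u' v' w' : Cn n) (μ' : EuclideanSpace ℝ (Fin a))
    (η' : EuclideanSpace ℝ (Fin b)) :
    fderiv ℝ (sharp F G) (u, v, w, μ, η) (u', v', w', μ', η') =
      fderiv ℝ F (u + w, μ) (u' + w', 0) + fderiv ℝ F (u + w, μ) (0, μ') +
      (fderiv ℝ G (v + w, η) (v' + w', 0) + fderiv ℝ G (v + w, η) (0, η')) +
      2 * (⟪u - v, Complex.I • w'⟫ + ⟪u' - v', Complex.I • w⟫) := by
  have dF := (hF.differentiable one_ne_zero (u + w, μ)).hasFDerivAt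
  have dG := (hG.differentiable one_ne_zero (v + w, η)).hasFDerivAt
  let E := Cn n × (Cn n × Cn n × EuclideanSpace ℝ (Fin a) × EuclideanSpace ℝ (Fin b))
  let p0 : E := (u, v, w, μ, η)
  let pu : E →L[ℝ] Cn n := ContinuousLinearMap.fst ℝ _ _
  let r1 : E →L[ℝ] _ := ContinuousLinearMap.snd ℝ _ _
  let pv : E →L[ℝ] Cn n := (ContinuousLinearMap.fst ℝ _ _).comp r1
  let r2 : E →L[ℝ] _ := (ContinuousLinearMap.snd ℝ _ _).comp r1
  let pw : E →L[ℝ] Cn n := (ContinuousLinearMap.fst ℝ _ _).comp r2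
  let r3 : E →L[ℝ] _ := (ContinuousLinearMap.snd ℝ _ _).comp r2
  let pm : E →L[ℝ] EuclideanSpace ℝ (Fin a) := (ContinuousLinearMap.fst ℝ _ _).comp r3
  let pe : E →L[ℝ] EuclideanSpace ℝ (Fin b) := (ContinuousLinearMap.snd ℝ _ _).comp r3
  have h1 : HasFDerivAt (fun p : E => F ((pu + pw).prod pm p)) _ p0 :=
    HasFDerivAt.comp p0 (g := F) dF ((pu + pw).prod pm).hasFDerivAt
  have h2 : HasFDerivAt (fun p : E => G ((pv + pw).prod pe p)) _ p0 :=
    HasFDerivAt.comp p0 (g := G) dG ((pv + pw).prod pe).hasFDerivAt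
  have h3 := (((pu - pv).hasFDerivAt (x := p0)).inner ℝ
    ((pw.hasFDerivAt (x := p0)).const_smul Complex.I)).const_mul 2
  have h := (h1.add h2).add h3
  have h' : HasFDerivAt (sharp F G) _ p0 := h
  have e1 : ∀ x : Cn n, ∀ m : EuclideanSpace ℝ (Fin a),
      fderiv ℝ F (u + w, μ) (x, 0) + fderiv ℝ F (u + w, μ) (0, m) =
      fderiv ℝ F (u + w, μ) (x, m) := by
    intro x m; rw [← map_add]; simp
  have e2 : ∀ x : Cn n, ∀ m : EuclideanSpace ℝ (Fin b),
      fderiv ℝ G (v + w, η) (x, 0) + fderiv ℝ G (v + w, η) (0, m) =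
      fderiv ℝ G (v + w, η) (x, m) := by
    intro x m; rw [← map_add]; simp
  rw [e1, e2, h'.fderiv]
  rfl

theorem mem_iff {n a b : ℕ}
    (F : Cn n × EuclideanSpace ℝ (Fin a) → ℝ) (G : Cn n × EuclideanSpace ℝ (Fin b) → ℝ)
    (hF : ContDiff ℝ 1 F) (hG : ContDiff ℝ 1 G) (z Z : Cn n) :
    (z, Z) ∈ GenSet (sharp F G) ↔ ∃ Y : Cn n, (z, Y) ∈ GenSet F ∧ (Y, Z) ∈ GenSet G := by
  have z1 : ∀ q, fderiv ℝ F q (0, 0) = 0 := fun q => map_zero (fderiv ℝ F q)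
  have z2 : ∀ q, fderiv ℝ G q (0, 0) = 0 := fun q => map_zero (fderiv ℝ G q)
  constructor
  · rintro ⟨⟨v, w, μ, η⟩, h1, h2⟩
    dsimp only at h1 h2
    have hu : ∀ x, fderiv ℝ F ((2:ℝ)⁻¹ • (z + Z) + w, μ) (x, 0)
        = ⟪Complex.I • (z - Z), x⟫ - 2 * ⟪x, Complex.I • w⟫ := by
      intro x
      have := h2 x
      rw [show ((x, 0) : Cn n × (Cn n × Cn n × EuclideanSpace ℝ (Fin a) ×
        EuclideanSpace ℝ (Fin b))) = (x, 0, 0, 0, 0) from rfl, fderiv_sharp F G hF hG] at this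
      simp [-smul_add, z1, z2] at this
      linarith
    have hv : ∀ x, fderiv ℝ G (v + w, η) (x, 0) = 2 * ⟪x, Complex.I • w⟫ := by
      intro x
      have := h1 (x, 0, 0, 0)
      rw [fderiv_sharp F G hF hG] at this
      simp [-smul_add, z1, z2] at this
      linarith
    have hw : ∀ x, fderiv ℝ F ((2:ℝ)⁻¹ • (z + Z) + w, μ) (x, 0) +
        fderiv ℝ G (v + w, η) (x, 0) + 2 * ⟪(2:ℝ)⁻¹ • (z + Z) - v, Complex.I • x⟫ = 0 := by
      intro x
      have := h1 (0, x, 0, 0)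
      rw [fderiv_sharp F G hF hG] at this
      simpa [-smul_add, z1, z2] using this
    have hm : ∀ m, fderiv ℝ F ((2:ℝ)⁻¹ • (z + Z) + w, μ) (0, m) = 0 := by
      intro x
      have := h1 (0, 0, x, 0)
      rw [fderiv_sharp F G hF hG] at this
      simpa [-smul_add, z1, z2] using this
    have he : ∀ m, fderiv ℝ G (v + w, η) (0, m) = 0 := by
      intro x
      have := h1 (0, 0, 0, x)
      rw [fderiv_sharp F G hF hG] at this
      simpa [-smul_add, z1, z2] using this
    have hvZ : v = Z := by
      have key : ∀ x : Cn n, ⟪v - Z, Complex.I • x⟫ = 0 := by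
        intro x
        have h3 := hw x
        rw [hu, hv, innerI] at h3
        simp only [inner_sub_left, inner_add_left, inner_smul_left] at h3 ⊢
        simp at h3
        linarith
      have h4 := key (-(Complex.I • (v - Z)))
      rw [smul_neg, smul_smul, Complex.I_mul_I, neg_one_smul, neg_neg, inner_self_eq_zero] at h4
      exact sub_eq_zero.mp h4
    subst hvZ
    have p1 : (2:ℝ)⁻¹ • (z + (v + (2:ℝ) • w)) = (2:ℝ)⁻¹ • (z + v) + w := by module
    have p2 : (2:ℝ)⁻¹ • ((v + (2:ℝ) • w) + v) = v + w := by module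
    refine ⟨v + (2:ℝ) • w, ⟨μ, ?_, ?_⟩, ⟨η, ?_, ?_⟩⟩
    · dsimp only; rw [p1]; exact hm
    · dsimp only; rw [p1]; intro x
      rw [hu, innerI, innerI, real_inner_comm (Complex.I • w) x, innerI]
      simp only [inner_sub_left, inner_add_left, real_inner_smul_left]
      ring
    · dsimp only; rw [p2]; exact he
    · dsimp only; rw [p2]; intro x
      rw [hv, innerI, real_inner_comm (Complex.I • w) x, innerI]
      simp only [inner_sub_left, inner_add_left, real_inner_smul_left]
      ring
  · rintro ⟨Y, ⟨μ, f1, f2⟩, ⟨η, g1, g2⟩⟩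
    dsimp only at f1 f2 g1 g2
    have p1 : (2:ℝ)⁻¹ • (z + Z) + (2:ℝ)⁻¹ • (Y - Z) = (2:ℝ)⁻¹ • (z + Y) := by module
    have p2 : Z + (2:ℝ)⁻¹ • (Y - Z) = (2:ℝ)⁻¹ • (Y + Z) := by module
    have c : ∀ x : Cn n, ⟪x, Complex.I • ((2:ℝ)⁻¹ • (Y - Z))⟫
        = - ((2:ℝ)⁻¹ * (⟪Y, Complex.I • x⟫ - ⟪Z, Complex.I • x⟫)) := by
      intro x
      rw [real_inner_comm, innerI, real_inner_smul_left, inner_sub_left]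
    refine ⟨(Z, (2:ℝ)⁻¹ • (Y - Z), μ, η), ?_, ?_⟩
    · rintro ⟨v', w', μ', η'⟩
      dsimp only
      rw [fderiv_sharp F G hF hG, p1, p2, f1, f2, g1, g2, c, innerI, innerI]
      simp only [inner_sub_left, inner_add_left, real_inner_smul_left, smul_add, smul_sub,
        inner_add_right, inner_sub_right, smul_zero, inner_zero_right, zero_add]
      ring
    · intro x
      dsimp only
      rw [show ((x, 0) : Cn n × (Cn n × Cn n × EuclideanSpace ℝ (Fin a) ×
        EuclideanSpace ℝ (Fin b))) = (x, 0, 0, 0, 0) from rfl]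
      rw [fderiv_sharp F G hF hG, p1, p2, f1, f2, g1, g2, c, innerI, innerI, innerI]
      simp only [inner_sub_left, inner_add_left, real_inner_smul_left, smul_add, smul_sub,
        inner_add_right, inner_sub_right, smul_zero, inner_zero_right, add_zero, sub_zero]
      ring

/-- The composition formula: `L(F♯G)` is the relational composition of `L(F)` and `L(G)`; in
particular if `F` generates `Φ` and `G` generates `Ψ` then `F♯G` generates `Ψ ∘ Φ`. -/
theorem composition_formula (n a b : ℕ)
    (F : Cn n × EuclideanSpace ℝ (Fin a) → ℝ) (G : Cn n × EuclideanSpace ℝ (Fin b) → ℝ)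
    (hF : ContDiff ℝ 1 F) (hG : ContDiff ℝ 1 G) :
    GenSet (sharp F G)
        = {p : Cn n × Cn n | ∃ Y : Cn n, (p.1, Y) ∈ GenSet F ∧ (Y, p.2) ∈ GenSet G} ∧
      ∀ (Φ Ψ : Cn n → Cn n), IsGenFun F Φ → IsGenFun G Ψ → IsGenFun (sharp F G) (Ψ ∘ Φ) := by
  have key : GenSet (sharp F G)
        = {p : Cn n × Cn n | ∃ Y : Cn n, (p.1, Y) ∈ GenSet F ∧ (Y, p.2) ∈ GenSet G} := by
    ext ⟨z, Z⟩
    exact mem_iff F G hF hG z Z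
  refine ⟨key, fun Φ Ψ h1 h2 => ?_⟩
  unfold IsGenFun at *
  rw [key, h1, h2]
  ext ⟨z, Z⟩
  simp
end

section
/- Let Φ : ℂ^n → ℂ^n satisfy Φ(λz) = λΦ(z) for all λ > 0 and all z, and let F : ℂ^n → ℝ be a differentiable function with F(0) = 0 such that {((z+Φ(z))/2, i(z−Φ(z))) : z ∈ ℂ^n} = {(q, ∇F(q)) : q ∈ ℂ^n}, where ∇F is the gradient of F with respect to the real inner product ⟨u,v⟩ = Re⟪u,v⟫. Then F is homogeneous of degree 2: F(λx) = λ²F(x) for all λ > 0 and all x ∈ ℂ^n. -/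
/-- A generating function without fiber variables for an `ℝ₊`-equivariant map `Φ` of `ℂⁿ`,
normalized by `F(0) = 0`, is homogeneous of degree `2`.  Here the hypothesis `hgen` says that
the Lagrangian `τ(graph Φ) = {((z+Φ(z))/2, i(z−Φ(z)))}` coincides with the graph of `dF`,
expressed via the gradient of `F` for the real inner product `⟨u,v⟩ = Re⟪u,v⟫`. -/
theorem homogeneous_of_equivariant_generating_function (n : ℕ) (Φ : Cn n → Cn n)
    (hΦ : ∀ lam : ℝ, 0 < lam → ∀ z, Φ (lam • z) = lam • Φ z)
    (F : Cn n → ℝ) (hdiff : Differentiable ℝ F) (hF0 : F 0 = 0)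
    (hgen : (Set.range fun z : Cn n => ((2 : ℝ)⁻¹ • (z + Φ z), Complex.I • (z - Φ z)))
      = Set.range fun q : Cn n => (q, gradient F q)) :
    ∀ lam : ℝ, 0 < lam → ∀ x : Cn n, F (lam • x) = lam ^ 2 * F x := by
  intro lam hlam
  have hgrad : ∀ q : Cn n, gradient F (lam • q) = lam • gradient F q := by
    intro q
    have h1 : (q, gradient F q) ∈ Set.range fun q : Cn n => (q, gradient F q) := ⟨q, rfl⟩
    rw [← hgen] at h1
    obtain ⟨z, hz⟩ := h1
    simp only [Prod.mk.injEq] at hz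
    have h2 : ((2 : ℝ)⁻¹ • (lam • z + Φ (lam • z)), Complex.I • (lam • z - Φ (lam • z)))
        ∈ Set.range fun q : Cn n => (q, gradient F q) := by
      rw [← hgen]; exact ⟨lam • z, rfl⟩
    obtain ⟨p, hp⟩ := h2
    simp only [Prod.mk.injEq] at hp
    obtain ⟨hp1, hp2⟩ := hp
    rw [hΦ lam hlam, ← smul_add, smul_comm, hz.1] at hp1
    rw [hΦ lam hlam, ← smul_sub, smul_comm, hz.2] at hp2
    rw [← hp1, hp2]
  have hfd : ∀ q : Cn n, fderiv ℝ F (lam • q) = lam • fderiv ℝ F q := by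
    intro q
    have h := hgrad q
    unfold gradient at h
    apply (InnerProductSpace.toDual ℝ (Cn n)).symm.injective
    rw [h, map_smulₛₗ]
    simp
  have hG : ∀ x : Cn n, HasFDerivAt (fun x => F (lam • x) - lam ^ 2 * F x)
      (0 : Cn n →L[ℝ] ℝ) x := by
    intro x
    have h1 : HasFDerivAt (fun x : Cn n => lam • x) (lam • ContinuousLinearMap.id ℝ (Cn n)) x :=
      (hasFDerivAt_id x).const_smul lam
    have h2 := (hdiff (lam • x)).hasFDerivAt.comp x h1
    have h3 := (hdiff x).hasFDerivAt.const_mul (lam ^ 2)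
    have h4 := h2.sub h3
    refine h4.congr_fderiv ?_
    rw [hfd]
    ext v
    simp
    ring
  intro x
  have hc := is_const_of_fderiv_eq_zero (𝕜 := ℝ) (fun x => (hG x).differentiableAt)
    (fun x => (hG x).fderiv) x 0
  simp only [smul_zero, hF0] at hc
  linarith
end

section
/- Let Φ : ℂ^n → ℂ^n satisfy Φ(−z) = −Φ(z) for all z, and let F : ℂ^n → ℝ be a differentiable function with F(0) = 0 such that {((z+Φ(z))/2, i(z−Φ(z))) : z ∈ ℂ^n} = {(q, ∇F(q)) : q ∈ ℂ^n}, where ∇F is the gradient of F with respect to the real inner product ⟨u,v⟩ = Re⟪u,v⟫. Then F is invariant under the antipodal ℤ₂-action: F(−x) = F(x) for all x ∈ ℂ^n. -/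
/-- A generating function without fiber variables for a `ℤ₂`-equivariant map `Φ` of `ℂⁿ`
(`Φ(−z) = −Φ(z)`), normalized by `F(0) = 0`, is invariant under the antipodal action.  Here the
hypothesis `hgen` says that the Lagrangian `τ(graph Φ) = {((z+Φ(z))/2, i(z−Φ(z)))}` coincides
with the graph of `dF`, expressed via the gradient of `F` for the real inner product
`⟨u,v⟩ = Re⟪u,v⟫`. -/
theorem invariant_of_equivariant_generating_function (n : ℕ) (Φ : Cn n → Cn n)
    (hΦ : ∀ z : Cn n, Φ (-z) = -Φ z)
    (F : Cn n → ℝ) (hdiff : Differentiable ℝ F) (hF0 : F 0 = 0)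
    (hgen : (Set.range fun z : Cn n => ((2 : ℝ)⁻¹ • (z + Φ z), Complex.I • (z - Φ z)))
      = Set.range fun q : Cn n => (q, gradient F q)) :
    ∀ x : Cn n, F (-x) = F x := by
  have hodd : ∀ q : Cn n, gradient F (-q) = -gradient F q := by
    intro q
    have h1 : (q, gradient F q) ∈ Set.range fun q : Cn n => (q, gradient F q) := ⟨q, rfl⟩
    rw [← hgen] at h1
    obtain ⟨z, hz⟩ := h1
    have hz1 := congrArg Prod.fst hz
    have hz2 := congrArg Prod.snd hz
    simp only at hz1 hz2
    have h2 : ((2 : ℝ)⁻¹ • (-z + Φ (-z)), Complex.I • (-z - Φ (-z))) ∈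
        Set.range fun q : Cn n => (q, gradient F q) := by
      rw [← hgen]
      exact ⟨-z, rfl⟩
    obtain ⟨p, hp⟩ := h2
    have hp1 := congrArg Prod.fst hp
    have hp2 := congrArg Prod.snd hp
    simp only at hp1 hp2
    have e1 : p = -q := by
      rw [hp1, ← hz1, hΦ, ← smul_neg, neg_add]
    rw [← e1, hp2, ← hz2, hΦ, ← smul_neg]
    congr 1
    abel
  have hfd : ∀ q : Cn n, fderiv ℝ F (-q) = -fderiv ℝ F q := by
    intro q
    have h := hodd q
    unfold gradient at h
    rw [← map_neg] at h
    exact (InnerProductSpace.toDual ℝ (Cn n)).symm.injective h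
  have hsum : ∀ x : Cn n, HasFDerivAt (fun x => F (-x) - F x) (0 : Cn n →L[ℝ] ℝ) x := by
    intro x
    have ha := (hdiff (-x)).hasFDerivAt.comp x (hasFDerivAt_id x).neg
    have hb := ha.sub (hdiff x).hasFDerivAt
    refine hb.congr_fderiv ?_
    rw [hfd]
    ext v
    simp
  intro x
  have hc := is_const_of_fderiv_eq_zero (𝕜 := ℝ) (f := fun x => F (-x) - F x)
    (fun x => (hsum x).differentiableAt) (fun x => (hsum x).fderiv) x 0
  simp only [neg_zero, sub_self] at hc
  linarith
end
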